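/- Necessity of blind selection: suppose the feature distribution supports the Cartesian product of possible feature values, and let ζ be a feature selector without leakage whose masks with positive probability always select exactly one feature (ζ(h|x) > 0 implies h has exactly one entry equal to 1). Then for every index i, the probability of selecting only feature i is constant over all instances: for all x, x' with p(x) > 0 and p(x') > 0, ζ(h_{only i} | x) = ζ(h_{only i} | x'), where h_{only i} is the mask with h[i] = 1 and h[j] = 0 for all j ≠ i. -/

import Mathlib

open Finset

noncomputable section

/-- A feature mask over `d` features: `true` means the feature is selected. -/
abbrev Mask (d : ℕ) := Fin d → Bool

variable {d : ℕ} {V : Fin d → Type*} {Y : Type*}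

/-- The masked feature vector `x ⊙ h`: selected features keep their value,
non-selected features are replaced by the masking symbol `none` (∅). -/
def applyMask (x : ∀ i, V i) (h : Mask d) : ∀ i, Option (V i) :=
  fun i => if h i then some (x i) else none

/-- The number of selected features `‖h‖₀`, as a real number. -/
def maskSize {d : ℕ} (h : Mask d) : ℝ :=
  ((Finset.univ.filter fun i => h i = true).card : ℝ)

section Leakage

variable [∀ i, Fintype (V i)] [∀ i, DecidableEq (V i)] [∀ i, Nonempty (V i)]
  [Fintype Y] [DecidableEq Y]

variable (p : (∀ i, V i) → Y → ℝ) (ζ : (∀ i, V i) → Mask d → ℝ)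

/-- Marginal probability `p(x)`. -/
def pX (x : ∀ i, V i) : ℝ := ∑ y, p x y

/-- `p` is a probability distribution on `X × Y`. -/
def IsDist : Prop := (∀ x y, 0 ≤ p x y) ∧ (∑ x, ∑ y, p x y) = 1

/-- `ζ` is a feature selector: for every `x` with `p(x) > 0`, `ζ(·|x)` is a
probability distribution over masks. -/
def IsSelector : Prop :=
  (∀ x h, 0 ≤ ζ x h) ∧ ∀ x, 0 < pX p x → (∑ h : Mask d, ζ x h) = 1

/-- `p(x[s^in])`: probability that the features selected by `h` take the values `x[s^in]`. -/
def pIn (h : Mask d) (x : ∀ i, V i) : ℝ :=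
  ∑ x' ∈ univ.filter (fun x' => applyMask x' h = applyMask x h), pX p x'

/-- `p(x[s^in], y)`. -/
def pInY (h : Mask d) (x : ∀ i, V i) (y : Y) : ℝ :=
  ∑ x' ∈ univ.filter (fun x' => applyMask x' h = applyMask x h), p x' y

/-- `p(x[s^in], h[s^in]=1, h[s^ex]=0)` under the joint distribution `p(x,y)·ζ(h|x)`. -/
def pInSel (h : Mask d) (x : ∀ i, V i) : ℝ :=
  ∑ x' ∈ univ.filter (fun x' => applyMask x' h = applyMask x h), pX p x' * ζ x' h

/-- `p(x[s^in], y, h[s^in]=1, h[s^ex]=0)`. -/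
def pInYSel (h : Mask d) (x : ∀ i, V i) (y : Y) : ℝ :=
  ∑ x' ∈ univ.filter (fun x' => applyMask x' h = applyMask x h), p x' y * ζ x' h

/-- `p(y | x[s^in])`. -/
def condLabel (h : Mask d) (x : ∀ i, V i) (y : Y) : ℝ := pInY p h x y / pIn p h x

/-- `p(y | x[s^in], h[s^in]=1, h[s^ex]=0)`. -/
def condLabelSel (h : Mask d) (x : ∀ i, V i) (y : Y) : ℝ :=
  pInYSel p ζ h x y / pInSel p ζ h x

/-- `p(x[s^ex] | x[s^in])`. -/
def condFeat (h : Mask d) (x : ∀ i, V i) : ℝ := pX p x / pIn p h x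

/-- `p(x[s^ex] | x[s^in], h[s^in]=1, h[s^ex]=0)`. -/
def condFeatSel (h : Mask d) (x : ∀ i, V i) : ℝ :=
  (pX p x * ζ x h) / pInSel p ζ h x

/-- `p(h[s^in]=1, h[s^ex]=0 | x[s^in])`. -/
def condSel (h : Mask d) (x : ∀ i, V i) : ℝ := pInSel p ζ h x / pIn p h x

/-- `p(h[s^in]=1, h[s^ex]=0 | x[s^in], y)`. -/
def condSelY (h : Mask d) (x : ∀ i, V i) (y : Y) : ℝ :=
  pInYSel p ζ h x y / pInY p h x y

/-- `p(h[s^in]=1, h[s^ex]=0 | x[s^in], x[s^ex])`. -/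
def condSelX (h : Mask d) (x : ∀ i, V i) : ℝ := (pX p x * ζ x h) / pX p x

/-- `p(h[s^in]=1, h[s^ex]=0 | x[s^in], x[s^ex], y)`. -/
def condSelXY (h : Mask d) (x : ∀ i, V i) (y : Y) : ℝ := (p x y * ζ x h) / (p x y)

/-- `(x, y, s^in, s^ex) ∈ Ω`, where `s^in`/`s^ex` are the sets of features
selected/not selected by the mask `h`. -/
def InOmega (h : Mask d) (x : ∀ i, V i) (y : Y) : Prop :=
  0 < pX p x ∧ 0 < ζ x h ∧ 0 < pInY p h x y

/-- `ζ` has no label leakage: conditioning the label distribution on the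
selection of features by `ζ` does not change the label distribution. -/
def NoLabelLeakage : Prop :=
  ∀ (h : Mask d) (x : ∀ i, V i) (y : Y), InOmega p ζ h x y →
    condLabel p h x y = condLabelSel p ζ h x y

/-- `ζ` has no feature leakage: conditioning the feature distribution on the
selection of features by `ζ` does not change the feature distribution. -/
def NoFeatureLeakage : Prop :=
  ∀ (h : Mask d) (x : ∀ i, V i) (y : Y), InOmega p ζ h x y →
    condFeat p h x = condFeatSel p ζ h x

/-- The feature distribution supports the Cartesian product of possible feature
values: if every coordinate value `a i` has positive marginal probability, then
the full assignment `a` has positive probability. -/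
def FullSupport : Prop :=
  ∀ a : ∀ i, V i,
    (∀ i : Fin d, 0 < ∑ x ∈ univ.filter (fun x : ∀ i, V i => x i = a i), pX p x) →
    0 < pX p a

/-- The mask `h_{only i}` selecting exactly feature `i`. -/
def onlyMask {d : ℕ} (i : Fin d) : Mask d := fun j => decide (j = i)

set_option linter.unusedSectionVars false

theorem exists_inOmega (hp : IsDist p) {x : ∀ i, V i} {h : Mask d}
    (hx : 0 < pX p x) (hh : 0 < ζ x h) : ∃ y, InOmega p ζ h x y := by
  obtain ⟨y, -, hy⟩ : ∃ y ∈ univ, 0 < p x y := by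
    by_contra! hc
    exact absurd hx (not_lt.mpr (Finset.sum_nonpos hc))
  refine ⟨y, hx, hh, hy.trans_le ?_⟩
  exact Finset.single_le_sum (f := fun x' => p x' y) (fun x' _ => hp.1 x' y) (by simp)

theorem pX_nonneg (hp : IsDist p) (x : ∀ i, V i) : 0 ≤ pX p x :=
  Finset.sum_nonneg fun y _ => hp.1 x y

theorem pX_le_pIn (hp : IsDist p) (h : Mask d) (x : ∀ i, V i) : pX p x ≤ pIn p h x :=
  Finset.single_le_sum (f := pX p) (fun x' _ => pX_nonneg p hp x') (by simp)

/-- Without feature leakage, a selection probability that is positive equals the conditional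
selection probability given the selected features. -/
theorem NoFeatureLeakage.pInSel_eq (hp : IsDist p) (hζ : IsSelector p ζ)
    (hnfl : NoFeatureLeakage p ζ) {x : ∀ i, V i} {h : Mask d}
    (hx : 0 < pX p x) (hh : 0 < ζ x h) : pInSel p ζ h x = ζ x h * pIn p h x := by
  obtain ⟨y, hy⟩ := exists_inOmega p ζ hp hx hh
  have hIn : 0 < pIn p h x := hx.trans_le (pX_le_pIn p hp h x)
  have hSel : 0 < pInSel p ζ h x := (mul_pos hx hh).trans_le <|
    Finset.single_le_sum (f := fun x' => pX p x' * ζ x' h)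
      (fun x' _ => mul_nonneg (pX_nonneg p hp x') (hζ.1 x' h)) (by simp)
  have key := hnfl h x y hy
  rw [condFeat, condFeatSel, div_eq_div_iff hIn.ne' hSel.ne', mul_assoc] at key
  exact mul_left_cancel₀ hx.ne' key

theorem NoFeatureLeakage.eq_of_applyMask_eq_of_pos (hp : IsDist p) (hζ : IsSelector p ζ)
    (hnfl : NoFeatureLeakage p ζ) {x x' : ∀ i, V i} {h : Mask d} (hx : 0 < pX p x)
    (hx' : 0 < pX p x') (hxx' : applyMask x' h = applyMask x h) (hh : 0 < ζ x h) :
    ζ x' h = ζ x h := by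
  have hsum : ∑ z ∈ univ.filter (fun z => applyMask z h = applyMask x h),
      pX p z * (ζ x h - ζ z h) = 0 := by
    have := hnfl.pInSel_eq p ζ hp hζ hx hh
    rw [pInSel, pIn, Finset.mul_sum] at this
    simp only [mul_sub, Finset.sum_sub_distrib, this, sub_eq_zero]
    exact Finset.sum_congr rfl fun z _ => mul_comm _ _
  have hnonneg : ∀ z ∈ univ.filter (fun z => applyMask z h = applyMask x h),
      0 ≤ pX p z * (ζ x h - ζ z h) := by
    intro z hz
    have hzx : applyMask z h = applyMask x h := (Finset.mem_filter.mp hz).2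
    rcases (pX_nonneg p hp z).eq_or_lt with hz0 | hz0
    · simp [← hz0]
    rcases (hζ.1 z h).eq_or_lt with hζ0 | hζ0
    · rw [← hζ0, sub_zero]
      exact (mul_pos hz0 hh).le
    have hz1 := hnfl.pInSel_eq p ζ hp hζ hz0 hζ0
    have hx1 := hnfl.pInSel_eq p ζ hp hζ hx hh
    have hIn : 0 < pIn p h x := hx.trans_le (pX_le_pIn p hp h x)
    simp only [pInSel, pIn, hzx] at hz1 hx1 hIn
    have := mul_right_cancel₀ hIn.ne' (hx1.symm.trans hz1)
    simp [this]
  have := (Finset.sum_eq_zero_iff_of_nonneg hnonneg).mp hsum x' (by simpa using hxx')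
  rcases mul_eq_zero.mp this with h0 | h0
  · exact absurd h0 hx'.ne'
  · linarith

/-- Without feature leakage, the selection probability depends on the selected features only. -/
theorem NoFeatureLeakage.eq_of_applyMask_eq (hp : IsDist p) (hζ : IsSelector p ζ)
    (hnfl : NoFeatureLeakage p ζ) {x x' : ∀ i, V i} {h : Mask d} (hx : 0 < pX p x)
    (hx' : 0 < pX p x') (hxx' : applyMask x' h = applyMask x h) :
    ζ x' h = ζ x h := by
  rcases (hζ.1 x h).eq_or_lt with h0 | h0
  · rcases (hζ.1 x' h).eq_or_lt with h1 | h1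
    · rw [← h0, ← h1]
    · exact (hnfl.eq_of_applyMask_eq_of_pos p ζ hp hζ hx' hx hxx'.symm h1).symm
  · exact hnfl.eq_of_applyMask_eq_of_pos p ζ hp hζ hx hx' hxx' h0

theorem applyMask_onlyMask_eq {x x' : ∀ i, V i} {i : Fin d} (h : x i = x' i) :
    applyMask x (onlyMask i) = applyMask x' (onlyMask i) := by
  funext j
  by_cases hj : j = i
  · subst hj
    simp [applyMask, h]
  · simp [applyMask, onlyMask, hj]

theorem onlyMask_injective : Function.Injective (onlyMask (d := d)) := by
  intro i j hij
  simpa [onlyMask] using congrFun hij i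

theorem mem_range_onlyMask {h : Mask d} (hh : (univ.filter fun j => h j = true).card = 1) :
    h ∈ Set.range (onlyMask (d := d)) := by
  obtain ⟨i, hi⟩ := Finset.card_eq_one.mp hh
  refine ⟨i, funext fun j => ?_⟩
  have := Finset.ext_iff.mp hi j
  simp only [Finset.mem_filter, Finset.mem_univ, true_and, Finset.mem_singleton] at this
  simp [onlyMask, ← this]

theorem sum_onlyMask (hζ : IsSelector p ζ)
    (hone : ∀ (x : ∀ i, V i) (h : Mask d), 0 < pX p x → 0 < ζ x h →
      (univ.filter fun j => h j = true).card = 1) {x : ∀ i, V i} (hx : 0 < pX p x) :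
    ∑ i, ζ x (onlyMask i) = 1 := by
  rw [← hζ.2 x hx]
  refine Fintype.sum_of_injective onlyMask onlyMask_injective _ _ (fun h hh => ?_) fun _ => rfl
  by_contra h0
  exact hh (mem_range_onlyMask (hone x h hx ((hζ.1 x h).lt_of_ne' h0)))

theorem FullSupport.pX_pos (hp : IsDist p) (hsupp : FullSupport p) {z : ∀ i, V i}
    (hz : ∀ i, ∃ x, 0 < pX p x ∧ x i = z i) : 0 < pX p z := by
  refine hsupp z fun i => ?_
  obtain ⟨x, hx, hxz⟩ := hz i
  exact hx.trans_le <| Finset.single_le_sum (f := pX p)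
    (fun x' _ => pX_nonneg p hp x') (by simpa using hxz)

/-- necessity of blind selection: if the feature distribution has
full Cartesian-product support and `ζ` is a leakage-free selector whose masks
with positive probability always select exactly one feature, then for every
index `i` the probability of selecting only feature `i` is constant over all
instances with positive probability. -/
theorem blind_selection_necessary
    (hp : IsDist p) (hζ : IsSelector p ζ) (hsupp : FullSupport p)
    (hnll : NoLabelLeakage p ζ) (hnfl : NoFeatureLeakage p ζ)
    (hone : ∀ (x : ∀ i, V i) (h : Mask d), 0 < pX p x → 0 < ζ x h →
      (univ.filter fun j => h j = true).card = 1) :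
    ∀ (i : Fin d) (x x' : ∀ i, V i), 0 < pX p x → 0 < pX p x' →
      ζ x (onlyMask i) = ζ x' (onlyMask i) := by
  intro i x x' hx hx'
  have hz : 0 < pX p (Function.update x i (x' i)) := by
    refine hsupp.pX_pos p hp fun j => ?_
    by_cases hj : j = i
    · subst hj
      exact ⟨x', hx', by simp⟩
    · exact ⟨x, hx, by simp [hj]⟩
  have hi : ζ (Function.update x i (x' i)) (onlyMask i) = ζ x' (onlyMask i) :=
    hnfl.eq_of_applyMask_eq p ζ hp hζ hx' hz (applyMask_onlyMask_eq (by simp))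
  have hne : ∀ j ∈ univ.erase i,
      ζ (Function.update x i (x' i)) (onlyMask j) = ζ x (onlyMask j) := fun j hj =>
    hnfl.eq_of_applyMask_eq p ζ hp hζ hx hz
      (applyMask_onlyMask_eq (by simp [Finset.ne_of_mem_erase hj]))
  have hsum := (sum_onlyMask p ζ hζ hone hz).trans (sum_onlyMask p ζ hζ hone hx).symm
  rw [← Finset.add_sum_erase univ _ (Finset.mem_univ i),
    ← Finset.add_sum_erase univ (fun j => ζ x (onlyMask j)) (Finset.mem_univ i),
    Finset.sum_congr rfl hne, hi] at hsum
  exact (add_right_cancel hsum).symm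

end Leakage

end
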